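/- arXiv:1411.1483 — 2 statements merged into one kernel-verified Lean document; each statement's English description precedes it below -/
import Mathlib

section
/- Let N_s = K·N_p (K ≥ 2) and let Q ≥ 0 with 2Q ≤ K−1. Let J and D_m be as follows: J is the N_p × N_s matrix with J_{m,n} = 1/K if n ≡ m (mod N_p) and 0 otherwise, and D_m = diag(e^{2πimn/N_s} : 0 ≤ n ≤ N_s−1). Let b ∈ ℂ^{N_s} be a random vector with independent zero-mean entries of variance (1−ε)P_s; let w_R, w_{Ds} ∈ ℂ^{N_s} be random vectors with independent zero-mean entries of variance σₙ²; let g be a zero-mean complex random variable with E|g|² = υ_g; let λ_{-Q},…,λ_Q be zero-mean uncorrelated complex random variables with Σ_{l=-Q}^{Q} E|λ_l|² = υ_h; and assume b, w_R, w_{Ds}, g, and (λ_l) are mutually independent. For −Q ≤ q ≤ Q define w_q = α g Σ_{l=-Q}^{Q} J D_{l−q} b · λ_l + J D_q^{H} ( α g w_R + w_{Ds} ), where α > 0 is a constant. Then E{ w_{q} w_{q}^{H} } = υₙ I_{N_p} with υₙ = ( α² υ_g υ_h (1−ε) P_s + (α² υ_g + 1) σₙ² ) / K, and E{ w_{q₁}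 w_{q₂}^{H} } = 0_{N_p} for q₁ ≠ q₂. -/
open MeasureTheory ProbabilityTheory Finset

open scoped ComplexConjugate

/-- The entries of the random vector `X` are pairwise orthogonal, with second moments `v`. -/
structure HasDiagonalSecondMoment {Ω ι : Type*} [MeasurableSpace Ω] (μ : Measure Ω)
    (X : Ω → ι → ℂ) (v : ι → ℂ) : Prop where
  integrable : ∀ a b, Integrable (fun ω => X ω a * conj (X ω b)) μ
  integral_self : ∀ a, ∫ ω, X ω a * conj (X ω a) ∂μ = v a
  integral_of_ne : ∀ a b, a ≠ b → ∫ ω, X ω a * conj (X ω b) ∂μ = 0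

/-- Prepend the constant entry `1` to a complex vector. -/
def adjoinOne {ι : Type*} (x : ι → ℂ) : Option ι → ℂ := fun o => o.elim 1 x

lemma measurable_adjoinOne_apply {β ι : Type*} [MeasurableSpace β] {f : β → ι → ℂ}
    (hf : ∀ i, Measurable fun x => f x i) (o : Option ι) :
    Measurable fun x => adjoinOne (f x) o := by
  cases o with
  | none => exact measurable_const
  | some i => exact hf i

namespace HasDiagonalSecondMoment

variable {Ω ι : Type*} [MeasurableSpace Ω] {μ : Measure Ω} {X : Ω → ι → ℂ} {v : ι → ℂ}

lemma of_memLp (hX : ∀ a, MemLp (fun ω => X ω a) 2 μ)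
    (hself : ∀ a, ((∫ ω, ‖X ω a‖ ^ 2 ∂μ : ℝ) : ℂ) = v a)
    (hne : ∀ a b, a ≠ b → ∫ ω, X ω a * conj (X ω b) ∂μ = 0) :
    HasDiagonalSecondMoment μ X v where
  integrable a b := (hX a).integrable_mul (hX b).star
  integral_self a := by
    rw [← hself, ← integral_complex_ofReal]
    simp [Complex.mul_conj']
  integral_of_ne := hne

lemma of_iIndepFun (hX : ∀ a, MemLp (fun ω => X ω a) 2 μ)
    (hind : iIndepFun (fun a ω => X ω a) μ) (hmean : ∀ a, ∫ ω, X ω a ∂μ = 0)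
    (hself : ∀ a, ((∫ ω, ‖X ω a‖ ^ 2 ∂μ : ℝ) : ℂ) = v a) :
    HasDiagonalSecondMoment μ X v := by
  refine of_memLp hX hself fun a b hab => ?_
  have h := (hind.indepFun hab).comp measurable_id Complex.continuous_conj.measurable
  have := h.integral_fun_mul_eq_mul_integral (hX a).1 (hX b).star.1
  simpa [hmean] using this

/-- Adjoining the constant `1` to centred orthogonal variables preserves orthogonality. -/
lemma adjoinOne [IsProbabilityMeasure μ] (h : HasDiagonalSecondMoment μ X v)
    (hX : ∀ a, Integrable (fun ω => X ω a) μ) (hmean : ∀ a, ∫ ω, X ω a ∂μ = 0) :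
    HasDiagonalSecondMoment μ (fun ω => adjoinOne (X ω)) (_root_.adjoinOne v) where
  integrable a b := by
    cases a <;> cases b <;> simp only [_root_.adjoinOne, Option.elim, map_one, one_mul, mul_one]
    · exact integrable_const _
    · exact Complex.conjCLE.toContinuousLinearMap.integrable_comp (hX _)
    · exact hX _
    · exact h.integrable _ _
  integral_self a := by
    cases a with
    | none => simp [_root_.adjoinOne]
    | some a => exact h.integral_self a
  integral_of_ne a b hab := by
    cases a <;> cases b <;> simp only [_root_.adjoinOne, Option.elim, map_one, one_mul, mul_one]
    · exact absurd rfl hab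
    · rw [integral_conj, hmean, map_zero]
    · exact hmean _
    · exact h.integral_of_ne _ _ fun e => hab (congrArg some e)

lemma comp_injective (h : HasDiagonalSecondMoment μ X v) {κ : Type*} {e : κ → ι}
    (he : Function.Injective e) :
    HasDiagonalSecondMoment μ (fun ω a => X ω (e a)) (fun a => v (e a)) where
  integrable _ _ := h.integrable _ _
  integral_self _ := h.integral_self _
  integral_of_ne _ _ hab := h.integral_of_ne _ _ (he.ne hab)

lemma integral_sum_mul_conj_sum [Fintype ι] (h : HasDiagonalSecondMoment μ X v) (c d : ι → ℂ) :
    ∫ ω, (∑ a, c a * X ω a) * conj (∑ a, d a * X ω a) ∂μ = ∑ a, c a * conj (d a) * v a := by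
  have hexp : ∀ ω, (∑ a, c a * X ω a) * conj (∑ a, d a * X ω a)
      = ∑ a, ∑ b, c a * conj (d b) * (X ω a * conj (X ω b)) := fun ω => by
    rw [map_sum, Finset.sum_mul_sum]
    refine Finset.sum_congr rfl fun a _ => Finset.sum_congr rfl fun b _ => ?_
    rw [map_mul]
    ring
  have hint : ∀ a b, Integrable (fun ω => c a * conj (d b) * (X ω a * conj (X ω b))) μ :=
    fun a b => (h.integrable a b).const_mul _
  simp_rw [hexp]
  rw [integral_finsetSum _ fun a _ => integrable_finsetSum _ fun b _ => hint a b]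
  refine Finset.sum_congr rfl fun a _ => ?_
  rw [integral_finsetSum _ fun b _ => hint a b, Finset.sum_eq_single a]
  · rw [integral_const_mul, h.integral_self]
  · intro b _ hb
    rw [integral_const_mul, h.integral_of_ne a b hb.symm, mul_zero]
  · simp

/-- Products of entries of five orthogonal families are orthogonal when the pairwise products
coming from different families are independent. -/
lemma prod_five {ι₀ ι₁ ι₂ ι₃ ι₄ : Type*} {X₀ : Ω → ι₀ → ℂ} {X₁ : Ω → ι₁ → ℂ} {X₂ : Ω → ι₂ → ℂ}
    {X₃ : Ω → ι₃ → ℂ} {X₄ : Ω → ι₄ → ℂ} {v₀ : ι₀ → ℂ} {v₁ : ι₁ → ℂ} {v₂ : ι₂ → ℂ} {v₃ : ι₃ → ℂ}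
    {v₄ : ι₄ → ℂ} (h₀ : HasDiagonalSecondMoment μ X₀ v₀) (h₁ : HasDiagonalSecondMoment μ X₁ v₁)
    (h₂ : HasDiagonalSecondMoment μ X₂ v₂) (h₃ : HasDiagonalSecondMoment μ X₃ v₃)
    (h₄ : HasDiagonalSecondMoment μ X₄ v₄)
    (hind : ∀ s t : ι₀ × ι₁ × ι₂ × ι₃ × ι₄, iIndepFun
      (![fun ω => X₀ ω s.1 * conj (X₀ ω t.1), fun ω => X₁ ω s.2.1 * conj (X₁ ω t.2.1),
        fun ω => X₂ ω s.2.2.1 * conj (X₂ ω t.2.2.1),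
        fun ω => X₃ ω s.2.2.2.1 * conj (X₃ ω t.2.2.2.1),
        fun ω => X₄ ω s.2.2.2.2 * conj (X₄ ω t.2.2.2.2)] : Fin 5 → Ω → ℂ) μ) :
    HasDiagonalSecondMoment μ
      (fun ω (s : ι₀ × ι₁ × ι₂ × ι₃ × ι₄) =>
        X₀ ω s.1 * X₁ ω s.2.1 * X₂ ω s.2.2.1 * X₃ ω s.2.2.2.1 * X₄ ω s.2.2.2.2)
      (fun s => v₀ s.1 * v₁ s.2.1 * v₂ s.2.2.1 * v₃ s.2.2.2.1 * v₄ s.2.2.2.2) := by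
  set Y : ι₀ × ι₁ × ι₂ × ι₃ × ι₄ → ι₀ × ι₁ × ι₂ × ι₃ × ι₄ → Fin 5 → Ω → ℂ := fun s t =>
    ![fun ω => X₀ ω s.1 * conj (X₀ ω t.1), fun ω => X₁ ω s.2.1 * conj (X₁ ω t.2.1),
      fun ω => X₂ ω s.2.2.1 * conj (X₂ ω t.2.2.1),
      fun ω => X₃ ω s.2.2.2.1 * conj (X₃ ω t.2.2.2.1),
      fun ω => X₄ ω s.2.2.2.2 * conj (X₄ ω t.2.2.2.2)]
  have hYint : ∀ s t k, Integrable (Y s t k) μ := by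
    intro s t k
    fin_cases k
    exacts [h₀.integrable _ _, h₁.integrable _ _, h₂.integrable _ _, h₃.integrable _ _,
      h₄.integrable _ _]
  have hprod : ∀ s t ω,
      X₀ ω s.1 * X₁ ω s.2.1 * X₂ ω s.2.2.1 * X₃ ω s.2.2.2.1 * X₄ ω s.2.2.2.2 *
        conj (X₀ ω t.1 * X₁ ω t.2.1 * X₂ ω t.2.2.1 * X₃ ω t.2.2.2.1 * X₄ ω t.2.2.2.2)
      = ∏ k, Y s t k ω := by
    intro s t ω
    simp only [map_mul, Y, Fin.prod_univ_five, Matrix.cons_val]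
    ring
  have hval : ∀ s t, ∫ ω, ∏ k, Y s t k ω ∂μ
      = (∫ ω, X₀ ω s.1 * conj (X₀ ω t.1) ∂μ) * (∫ ω, X₁ ω s.2.1 * conj (X₁ ω t.2.1) ∂μ)
        * (∫ ω, X₂ ω s.2.2.1 * conj (X₂ ω t.2.2.1) ∂μ)
        * (∫ ω, X₃ ω s.2.2.2.1 * conj (X₃ ω t.2.2.2.1) ∂μ)
        * (∫ ω, X₄ ω s.2.2.2.2 * conj (X₄ ω t.2.2.2.2) ∂μ) := by
    intro s t
    rw [(hind s t).integral_fun_prod_eq_prod_integral fun k => (hYint s t k).1]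
    simp only [Fin.prod_univ_five, Matrix.cons_val]
  refine ⟨fun s t => ?_, fun s => ?_, fun s t hst => ?_⟩
  · simp_rw [hprod]
    have := (hind s t).isProbabilityMeasure
    have hm : ∀ k, AEMeasurable (Y s t k) μ := fun k => (hYint s t k).1.aemeasurable
    have hpi : Integrable (fun x : Fin 5 → ℂ => ∏ k, x k) (μ.map fun ω k => Y s t k ω) := by
      rw [(hind s t).map_fun_eq_pi_map hm]
      exact Integrable.fintype_prod (f := fun _ x => x) fun k =>
        (integrable_map_measure aestronglyMeasurable_id (hm k)).2 (hYint s t k)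
    exact hpi.comp_aemeasurable (aemeasurable_pi_lambda _ hm)
  · simp_rw [hprod]
    rw [hval, h₀.integral_self, h₁.integral_self, h₂.integral_self, h₃.integral_self,
      h₄.integral_self]
  · simp_rw [hprod]
    rw [hval]
    obtain ⟨s₀, s₁, s₂, s₃, s₄⟩ := s
    obtain ⟨t₀, t₁, t₂, t₃, t₄⟩ := t
    by_cases e₀ : s₀ = t₀
    · by_cases e₁ : s₁ = t₁
      · by_cases e₂ : s₂ = t₂
        · by_cases e₃ : s₃ = t₃
          · have e₄ : s₄ ≠ t₄ := fun e₄ => hst (by rw [e₀, e₁, e₂, e₃, e₄])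
            simp [h₄.integral_of_ne _ _ e₄]
          · simp [h₃.integral_of_ne _ _ e₃]
        · simp [h₂.integral_of_ne _ _ e₂]
      · simp [h₁.integral_of_ne _ _ e₁]
    · simp [h₀.integral_of_ne _ _ e₀]

end HasDiagonalSecondMoment

/-- The factors drawn from `(b, w_R, w_{Ds}, g, λ)` in the summands `g b_n λ_l`, `g (w_R)_n` and
`(w_{Ds})_n` of the residual noise. -/
def factorIndex {L ι : Type*} : (L × ι) ⊕ (ι ⊕ ι) →
    Option ι × Option ι × Option ι × Option Unit × Option L :=
  Sum.elim (fun p => (some p.2, none, none, some (), some p.1))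
    (Sum.elim (fun n => (none, some n, none, some (), none))
      fun n => (none, none, some n, none, none))

lemma factorIndex_injective {L ι : Type*} :
    Function.Injective (factorIndex : (L × ι) ⊕ (ι ⊕ ι) → _) := by
  rintro (⟨l, n⟩ | n | n) (⟨l', n'⟩ | n' | n') h <;>
    simp only [factorIndex, Sum.elim_inl, Sum.elim_inr, Prod.mk.injEq, Option.some.injEq,
      reduceCtorEq, and_false, false_and] at h
  · obtain ⟨rfl, -, -, -, rfl⟩ := h
    rfl
  · rw [h.2.1]
  · rw [h.2.2.1]

/-- The complex exponential `e^{2πi m n / N}`. -/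
noncomputable def phase (N : ℕ) (m : ℤ) (n : ℕ) : ℂ :=
  Complex.exp (2 * (Real.pi : ℂ) * Complex.I * (m : ℂ) * (n : ℂ) / (N : ℂ))

lemma conj_phase (N : ℕ) (m : ℤ) (n : ℕ) : conj (phase N m n) = phase N (-m) n := by
  rw [phase, phase, ← Complex.exp_conj]
  congr 1
  simp [Complex.conj_ofNat]

lemma phase_mul_phase (N : ℕ) (m m' : ℤ) (n : ℕ) :
    phase N m n * phase N m' n = phase N (m + m') n := by
  rw [phase, phase, phase, ← Complex.exp_add]
  congr 1
  push_cast
  ring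

/-- A nontrivial `K`-th root of unity sums to zero along the `K` samples of a residue class. -/
lemma sum_phase_residueClass (K Np : ℕ) (hK : 0 < K) (hNp : 0 < Np) (d : ℤ) (hd : |d| < K)
    (i : ℕ) : ∑ k : Fin K, phase (K * Np) d (i + Np * k) = if d = 0 then (K : ℂ) else 0 := by
  split_ifs with h0
  · simp [phase, h0]
  have hKc : (K : ℂ) ≠ 0 := by exact_mod_cast hK.ne'
  have hNc : (Np : ℂ) ≠ 0 := by exact_mod_cast hNp.ne'
  set r : ℂ := Complex.exp (2 * (Real.pi : ℂ) * Complex.I * d / K) with hr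
  have hterm : ∀ k : ℕ, phase (K * Np) d (i + Np * k) = phase (K * Np) d i * r ^ k := by
    intro k
    rw [hr, ← Complex.exp_nat_mul, phase, phase, ← Complex.exp_add]
    congr 1
    push_cast
    field_simp
  have hr1 : r ≠ 1 := by
    intro h
    obtain ⟨n, hn⟩ := Complex.exp_eq_one_iff.1 h
    have h2 : (d : ℂ) = n * K := by
      have hpi := Complex.two_pi_I_ne_zero
      rw [div_eq_iff hKc] at hn
      apply mul_left_cancel₀ hpi
      rw [hn]
      ring
    have h3 : d = n * K := by exact_mod_cast h2
    exact h0 (Int.eq_zero_of_abs_lt_dvd ⟨n, by rw [h3, mul_comm]⟩ hd)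
  have hrK : r ^ K = 1 := by
    rw [hr, ← Complex.exp_nat_mul, Complex.exp_eq_one_iff]
    exact ⟨d, by field_simp⟩
  simp_rw [hterm]
  rw [← Finset.mul_sum, Fin.sum_univ_eq_sum_range (fun k => r ^ k), geom_sum_eq hr1, hrK]
  simp

lemma sum_despreading_mul_phase (K Np : ℕ) (hK : 0 < K) (hNp : 0 < Np)
    (J : Matrix (Fin Np) (Fin (K * Np)) ℂ)
    (hJ : ∀ (m : Fin Np) (n : Fin (K * Np)),
      J m n = if (n : ℕ) % Np = (m : ℕ) then (1 / (K : ℂ)) else 0)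
    (d : ℤ) (hd : |d| < K) (i j : Fin Np) :
    ∑ n, J i n * conj (J j n) * phase (K * Np) d n
      = if i = j ∧ d = 0 then 1 / (K : ℂ) else 0 := by
  have hKc : (K : ℂ) ≠ 0 := by exact_mod_cast hK.ne'
  rw [← finProdFinEquiv.sum_comp, Fintype.sum_prod_type_right]
  have hmod : ∀ (k : Fin K) (m m' : Fin Np),
      J m (finProdFinEquiv (k, m')) = if m' = m then 1 / (K : ℂ) else 0 := by
    intro k m m'
    rw [hJ]
    simp [finProdFinEquiv, Nat.mod_eq_of_lt, Fin.ext_iff]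
  simp_rw [hmod]
  rw [Finset.sum_eq_single i (fun m _ hm => by simp [hm]) (by simp)]
  have hsum := sum_phase_residueClass K Np hK hNp d hd i
  by_cases hij : i = j
  · have : ∀ k : Fin K, ((finProdFinEquiv (k, i) : Fin (K * Np)) : ℕ) = i + Np * k := fun _ => rfl
    subst hij
    simp only [this, if_true, true_and]
    rw [← Finset.mul_sum, hsum]
    split_ifs
    · simp
      field_simp
    · simp
  · simp [hij]

set_option maxHeartbeats 400000 in
/-- In the superimposed-training receiver, the residual interference-plus-noise
vectors `w_q = α g Σ_l J D_{l−q} b λ_l + J D_qᴴ (α g w_R + w_{Ds})`, `−Q ≤ q ≤ Q`, are white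
and mutually uncorrelated: `E{w_q w_qᴴ} = υₙ I_{N_p}` with
`υₙ = (α² υ_g υ_h (1−ε) P_s + (α² υ_g + 1) σₙ²)/K`, and `E{w_{q₁} w_{q₂}ᴴ} = 0` for `q₁ ≠ q₂`. -/
theorem despread_noise_covariance
    {Ω : Type*} [MeasurableSpace Ω] (μ : Measure Ω) [IsProbabilityMeasure μ]
    (K Np : ℕ) (hK : 2 ≤ K) (hNp : 1 ≤ Np) (Q : ℕ) (hQ : (2 * Q : ℤ) ≤ (K : ℤ) - 1)
    (ε Ps σn2 υg υh α : ℝ) (hα : 0 < α)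
    -- the de-spreading and modulation matrices
    (J : Matrix (Fin Np) (Fin (K * Np)) ℂ)
    (hJ : ∀ (m : Fin Np) (n : Fin (K * Np)),
      J m n = if (n : ℕ) % Np = (m : ℕ) then (1 / (K : ℂ)) else 0)
    (D : ℤ → Matrix (Fin (K * Np)) (Fin (K * Np)) ℂ)
    (hD : ∀ q : ℤ, D q = Matrix.diagonal (fun n : Fin (K * Np) =>
      Complex.exp (2 * (Real.pi : ℂ) * Complex.I * (q : ℂ) * ((n : ℕ) : ℂ)
        / ((K * Np : ℕ) : ℂ))))
    -- the random data, noises, backhaul channel and BEM coefficients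
    (b wR wDs : Ω → Fin (K * Np) → ℂ) (g : Ω → ℂ) (lam : Ω → ℤ → ℂ) (vlam : ℤ → ℝ)
    (hb_meas : ∀ n, Measurable fun ω => b ω n)
    (hwR_meas : ∀ n, Measurable fun ω => wR ω n)
    (hwDs_meas : ∀ n, Measurable fun ω => wDs ω n)
    (hg_meas : Measurable g)
    (hlam_meas : ∀ l, Measurable fun ω => lam ω l)
    (hb_L2 : ∀ n, MemLp (fun ω => b ω n) 2 μ)
    (hwR_L2 : ∀ n, MemLp (fun ω => wR ω n) 2 μ)
    (hwDs_L2 : ∀ n, MemLp (fun ω => wDs ω n) 2 μ)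
    (hg_L2 : MemLp g 2 μ)
    (hlam_L2 : ∀ l, MemLp (fun ω => lam ω l) 2 μ)
    -- `b` has independent zero-mean entries of variance `(1−ε)P_s`
    (hb_indep : iIndepFun (fun n ω => b ω n) μ)
    (hb_mean : ∀ n, ∫ ω, b ω n ∂μ = 0)
    (hb_var : ∀ n, ∫ ω, ‖b ω n‖ ^ 2 ∂μ = (1 - ε) * Ps)
    -- `w_R`, `w_{Ds}` have independent zero-mean entries of variance `σₙ²`
    (hwR_indep : iIndepFun (fun n ω => wR ω n) μ)
    (hwR_mean : ∀ n, ∫ ω, wR ω n ∂μ = 0)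
    (hwR_var : ∀ n, ∫ ω, ‖wR ω n‖ ^ 2 ∂μ = σn2)
    (hwDs_indep : iIndepFun (fun n ω => wDs ω n) μ)
    (hwDs_mean : ∀ n, ∫ ω, wDs ω n ∂μ = 0)
    (hwDs_var : ∀ n, ∫ ω, ‖wDs ω n‖ ^ 2 ∂μ = σn2)
    -- `g` is zero-mean with `E|g|² = υ_g`
    (hg_mean : ∫ ω, g ω ∂μ = 0)
    (hg_var : ∫ ω, ‖g ω‖ ^ 2 ∂μ = υg)
    -- the BEM coefficients are zero-mean, uncorrelated, with total variance `υ_h`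
    (hlam_mean : ∀ l ∈ Icc (-(Q : ℤ)) (Q : ℤ), ∫ ω, lam ω l ∂μ = 0)
    (hlam_uncorr : ∀ l ∈ Icc (-(Q : ℤ)) (Q : ℤ), ∀ l' ∈ Icc (-(Q : ℤ)) (Q : ℤ), l ≠ l' →
      ∫ ω, lam ω l * (starRingEnd ℂ) (lam ω l') ∂μ = 0)
    (hlam_var : ∀ l ∈ Icc (-(Q : ℤ)) (Q : ℤ), ∫ ω, ‖lam ω l‖ ^ 2 ∂μ = vlam l)
    (hlam_sumvar : ∑ l ∈ Icc (-(Q : ℤ)) (Q : ℤ), vlam l = υh)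
    -- `b`, `w_R`, `w_{Ds}`, `g` and `(λ_l)` are mutually independent
    (hmutual : iIndepFun
      (![fun ω => (b ω, 0, 0, 0, 0), fun ω => (0, wR ω, 0, 0, 0),
         fun ω => (0, 0, wDs ω, 0, 0), fun ω => (0, 0, 0, g ω, 0),
         fun ω => (0, 0, 0, 0, lam ω)] :
        Fin 5 → Ω → (Fin (K * Np) → ℂ) × (Fin (K * Np) → ℂ) × (Fin (K * Np) → ℂ) × ℂ
          × (ℤ → ℂ)) μ)
    -- the residual noise vectors and the effective noise variance
    (w : ℤ → Ω → Fin Np → ℂ)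
    (hw : ∀ (q : ℤ) (ω : Ω), w q ω = fun i =>
      (α : ℂ) * g ω *
          (∑ l ∈ Icc (-(Q : ℤ)) (Q : ℤ), (J.mulVec ((D (l - q)).mulVec (b ω))) i * lam ω l)
        + (J.mulVec ((D q).conjTranspose.mulVec
            (fun n => (α : ℂ) * g ω * wR ω n + wDs ω n))) i)
    (υn : ℝ)
    (hυn : υn = (α ^ 2 * υg * υh * (1 - ε) * Ps + (α ^ 2 * υg + 1) * σn2) / K) :
    (∀ q ∈ Icc (-(Q : ℤ)) (Q : ℤ), ∀ i j : Fin Np,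
      ∫ ω, w q ω i * (starRingEnd ℂ) (w q ω j) ∂μ = if i = j then (υn : ℂ) else 0) ∧
    (∀ q₁ ∈ Icc (-(Q : ℤ)) (Q : ℤ), ∀ q₂ ∈ Icc (-(Q : ℤ)) (Q : ℤ), q₁ ≠ q₂ →
      ∀ i j : Fin Np, ∫ ω, w q₁ ω i * (starRingEnd ℂ) (w q₂ ω j) ∂μ = 0) := by
  have hKpos : 0 < K := by omega
  have hmain : ∀ q₁ ∈ Icc (-(Q : ℤ)) (Q : ℤ), ∀ q₂ ∈ Icc (-(Q : ℤ)) (Q : ℤ), ∀ i j : Fin Np,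
      ∫ ω, w q₁ ω i * (starRingEnd ℂ) (w q₂ ω j) ∂μ
        = if i = j ∧ q₂ - q₁ = 0 then (υn : ℂ) else 0 := by
    intro q₁ hq₁ q₂ hq₂ i j
    rw [Finset.mem_Icc] at hq₁ hq₂
    have hd : |q₂ - q₁| < K := by rw [abs_lt]; omega
    let L := {l // l ∈ Icc (-(Q : ℤ)) (Q : ℤ)}
    let v₀ : Fin (K * Np) → ℂ := fun _ => (((1 - ε) * Ps : ℝ) : ℂ)
    let v₁ : Fin (K * Np) → ℂ := fun _ => (σn2 : ℂ)
    let v₃ : Unit → ℂ := fun _ => (υg : ℂ)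
    let v₄ : L → ℂ := fun l => (vlam l : ℂ)
    have h₀ : HasDiagonalSecondMoment μ (fun ω => adjoinOne (b ω)) (adjoinOne v₀) :=
      (HasDiagonalSecondMoment.of_iIndepFun hb_L2 hb_indep hb_mean
        fun n => by rw [hb_var]).adjoinOne
        (fun n => (hb_L2 n).integrable one_le_two) hb_mean
    have h₁ : HasDiagonalSecondMoment μ (fun ω => adjoinOne (wR ω)) (adjoinOne v₁) :=
      (HasDiagonalSecondMoment.of_iIndepFun hwR_L2 hwR_indep hwR_mean
        fun n => by rw [hwR_var]).adjoinOne
        (fun n => (hwR_L2 n).integrable one_le_two) hwR_mean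
    have h₂ : HasDiagonalSecondMoment μ (fun ω => adjoinOne (wDs ω)) (adjoinOne v₁) :=
      (HasDiagonalSecondMoment.of_iIndepFun hwDs_L2 hwDs_indep hwDs_mean
        fun n => by rw [hwDs_var]).adjoinOne
        (fun n => (hwDs_L2 n).integrable one_le_two) hwDs_mean
    have h₃ : HasDiagonalSecondMoment μ (fun ω => adjoinOne fun _ : Unit => g ω)
        (adjoinOne v₃) :=
      (HasDiagonalSecondMoment.of_memLp (X := fun ω (_ : Unit) => g ω) (fun _ => hg_L2)
        (fun _ => by rw [hg_var]) fun a b hab => absurd rfl hab).adjoinOne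
        (fun _ => hg_L2.integrable one_le_two) fun _ => hg_mean
    have h₄ : HasDiagonalSecondMoment μ (fun ω => adjoinOne fun l : L => lam ω l)
        (adjoinOne v₄) :=
      (HasDiagonalSecondMoment.of_memLp (X := fun ω (l : L) => lam ω l) (fun l => hlam_L2 l)
        (fun l => by rw [hlam_var l l.2]) fun l l' hl =>
          hlam_uncorr l l.2 l' l'.2 fun e => hl (Subtype.ext e)).adjoinOne
        (fun l => (hlam_L2 l).integrable one_le_two) fun l => hlam_mean l l.2
    have h := h₀.prod_five h₁ h₂ h₃ h₄ (fun s t => by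
      have hc := hmutual.comp
        (![fun p => adjoinOne p.1 s.1 * conj (adjoinOne p.1 t.1),
          fun p => adjoinOne p.2.1 s.2.1 * conj (adjoinOne p.2.1 t.2.1),
          fun p => adjoinOne p.2.2.1 s.2.2.1 * conj (adjoinOne p.2.2.1 t.2.2.1),
          fun p => adjoinOne (fun _ : Unit => p.2.2.2.1) s.2.2.2.1
            * conj (adjoinOne (fun _ : Unit => p.2.2.2.1) t.2.2.2.1),
          fun p => adjoinOne (fun l : L => p.2.2.2.2 l) s.2.2.2.2
            * conj (adjoinOne (fun l : L => p.2.2.2.2 l) t.2.2.2.2)] :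
          Fin 5 → (Fin (K * Np) → ℂ) × (Fin (K * Np) → ℂ) × (Fin (K * Np) → ℂ) × ℂ
            × (ℤ → ℂ) → ℂ) (fun k => by
          have hcm := Complex.continuous_conj.measurable
          fin_cases k <;>
          exact (measurable_adjoinOne_apply (fun _ => by fun_prop) _).mul
            (hcm.comp (measurable_adjoinOne_apply (fun _ => by fun_prop) _)))
      convert hc using 1
      ext k ω
      fin_cases k <;> rfl)
    let c : ℤ → Fin Np → (L × Fin (K * Np)) ⊕ (Fin (K * Np) ⊕ Fin (K * Np)) → ℂ := fun q i =>
      Sum.elim (fun p => α * (J i p.2 * phase (K * Np) (p.1 - q) p.2))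
        (Sum.elim (fun n => α * (J i n * phase (K * Np) (-q) n))
          fun n => J i n * phase (K * Np) (-q) n)
    have hDp : ∀ q, D q = Matrix.diagonal fun n : Fin (K * Np) => phase (K * Np) q n := hD
    have hexp := (h.comp_injective factorIndex_injective).integral_sum_mul_conj_sum (c q₁ i) (c q₂ j)
    have hwsum : ∀ q i ω, w q ω i = ∑ a, c q i a * (adjoinOne (b ω) (factorIndex a).1
        * adjoinOne (wR ω) (factorIndex a).2.1 * adjoinOne (wDs ω) (factorIndex a).2.2.1
        * adjoinOne (fun _ : Unit => g ω) (factorIndex a).2.2.2.1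
        * adjoinOne (fun l : L => lam ω l) (factorIndex a).2.2.2.2) := by
      intro q i ω
      rw [hw, Fintype.sum_sum_type, Fintype.sum_sum_type, Fintype.sum_prod_type]
      simp only [c, factorIndex, Sum.elim_inl, Sum.elim_inr, adjoinOne, Option.elim, mul_one, one_mul]
      congr 1
      · rw [← Finset.sum_coe_sort, Finset.mul_sum]
        refine Finset.sum_congr rfl fun l _ => ?_
        simp only [hDp, Matrix.mulVec, dotProduct, Matrix.diagonal_apply, ite_mul, zero_mul,
          Finset.sum_ite_eq, Finset.mem_univ, if_true]
        rw [Finset.sum_mul, Finset.mul_sum]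
        exact Finset.sum_congr rfl fun n _ => by ring
      · rw [← Finset.sum_add_distrib]
        simp only [hDp, Matrix.diagonal_conjTranspose, Matrix.mulVec, dotProduct,
          Matrix.diagonal_apply, ite_mul, zero_mul, Finset.sum_ite_eq, Finset.mem_univ, if_true,
          Pi.star_apply, ← conj_phase, starRingEnd_apply]
        exact Finset.sum_congr rfl fun n _ => by ring
    simp_rw [hwsum]
    rw [hexp]
    set S := ∑ n, J i n * conj (J j n) * phase (K * Np) (q₂ - q₁) n with hS
    have hphase : ∀ (l : ℤ) (n : ℕ), phase (K * Np) (l - q₁) n * conj (phase (K * Np) (l - q₂) n)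
        = phase (K * Np) (q₂ - q₁) n := fun l n => by
      rw [conj_phase, phase_mul_phase]
      congr 1
      ring
    have hphase₀ : ∀ n : ℕ, phase (K * Np) (-q₁) n * conj (phase (K * Np) (-q₂) n)
        = phase (K * Np) (q₂ - q₁) n := fun n => by
      simpa using hphase 0 n
    have hυh : (υh : ℂ) = ∑ l : L, (vlam l : ℂ) := by
      rw [← hlam_sumvar, Complex.ofReal_sum, ← Finset.sum_coe_sort]
    have htotal : ∑ a, c q₁ i a * conj (c q₂ j a) * (adjoinOne v₀ (factorIndex a).1
        * adjoinOne v₁ (factorIndex a).2.1 * adjoinOne v₁ (factorIndex a).2.2.1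
        * adjoinOne v₃ (factorIndex a).2.2.2.1 * adjoinOne v₄ (factorIndex a).2.2.2.2)
        = (α ^ 2 * υg * υh * (1 - ε) * Ps + (α ^ 2 * υg + 1) * σn2) * S := by
      rw [Fintype.sum_sum_type, Fintype.sum_sum_type, Fintype.sum_prod_type]
      simp only [c, factorIndex, Sum.elim_inl, Sum.elim_inr, adjoinOne, Option.elim, mul_one, one_mul,
        v₀, v₁, v₃, v₄, map_mul, Complex.conj_ofReal]
      rw [add_mul, ← Finset.sum_add_distrib]
      congr 1
      · have : (α ^ 2 * υg * υh * (1 - ε) * Ps : ℂ) * S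
            = ∑ l : L, α ^ 2 * υg * vlam l * (1 - ε) * Ps * S := by
          rw [hυh]
          simp only [Finset.sum_mul, Finset.mul_sum]
        rw [this]
        refine Finset.sum_congr rfl fun l _ => ?_
        rw [hS, Finset.mul_sum]
        refine Finset.sum_congr rfl fun n _ => ?_
        rw [← hphase l n]
        push_cast
        ring
      · rw [hS, Finset.mul_sum]
        refine Finset.sum_congr rfl fun n _ => ?_
        rw [← hphase₀ n]
        ring
    rw [htotal, hS, sum_despreading_mul_phase K Np hKpos hNp J hJ _ hd, hυn]
    split_ifs
    · push_cast
      ring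
    · simp
  refine ⟨fun q hq i j => ?_, fun q₁ hq₁ q₂ hq₂ hne i j => ?_⟩
  · simpa using hmain q hq q hq i j
  · rw [hmain q₁ hq₁ q₂ hq₂ i j, if_neg fun h => hne (sub_eq_zero.1 h.2).symm]
end

section
/- Let Q ≥ 0, α, υₙ, σₙ², υ_g > 0, λ ∈ ℂ^{2Q+1}, t̃ₛ ∈ ℂ^{N_p}, t_r ∈ ℂ^{N_r}, with A = α²‖λ‖²‖t̃ₛ‖²/υₙ + ‖t_r‖²/σₙ² > 0. Let g be a zero-mean complex random variable with E|g|² = υ_g, and let w_{-Q},…,w_Q ∈ ℂ^{N_p} and w_{Dr} ∈ ℂ^{N_r} be zero-mean random vectors, independent of g, satisfying E{w_q w_qᴴ} = υₙ I_{N_p}, E{w_{q₁} w_{q₂}ᴴ} = 0 for q₁ ≠ q₂, E{w_{Dr} w_{Dr}ᴴ} = σₙ² I_{N_r}, and E{w_q w_{Dr}ᴴ} = 0. Set r_q = α g λ_q t̃ₛ + w_q, x_r = g t_r + w_{Dr}, and define the MAP estimate ĝ^{MAP} = ( Σ_{q=-Q}^{Q} α \bar{λ_q} (t̃ₛᴴ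 r_q)/υₙ + (t_rᴴ x_r)/σₙ² ) / ( A + 1/υ_g ). Then E| ĝ^{MAP} − g |² = (1/A) · υ_g/( υ_g + 1/A ) = υ_g/( A υ_g + 1 ). -/
open MeasureTheory ProbabilityTheory Finset

/-- The mean square of a linear combination of pairwise uncorrelated square-integrable
complex random variables. -/
theorem integral_norm_sq_sum_of_uncorrelated {Ω ι : Type*} [MeasurableSpace Ω] [Fintype ι]
    {μ : Measure Ω} (X : ι → Ω → ℂ) (c : ι → ℂ) (v : ι → ℝ)
    (hX : ∀ k, MemLp (X k) 2 μ)
    (hvar : ∀ k, ∫ ω, X k ω * (starRingEnd ℂ) (X k ω) ∂μ = v k)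
    (hcov : ∀ k l, k ≠ l → ∫ ω, X k ω * (starRingEnd ℂ) (X l ω) ∂μ = 0) :
    ∫ ω, ‖∑ k, c k * X k ω‖ ^ 2 ∂μ = ∑ k, ‖c k‖ ^ 2 * v k := by
  have h_int : ∀ k l, Integrable (fun ω => X k ω * (starRingEnd ℂ) (X l ω)) μ :=
    fun k l => (hX k).integrable_mul (hX l).star
  have h_expand : ∀ ω, ((‖∑ k, c k * X k ω‖ ^ 2 : ℝ) : ℂ) =
      ∑ k, ∑ l, c k * (starRingEnd ℂ) (c l) * (X k ω * (starRingEnd ℂ) (X l ω)) := by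
    intro ω
    rw [Complex.ofReal_pow, ← Complex.mul_conj', map_sum, Finset.sum_mul_sum]
    refine Finset.sum_congr rfl fun k _ => Finset.sum_congr rfl fun l _ => ?_
    rw [map_mul]
    ring
  apply Complex.ofReal_injective
  rw [← integral_complex_ofReal]
  simp_rw [h_expand]
  rw [integral_finsetSum _ fun k _ => integrable_finsetSum _ fun l _ => (h_int k l).const_mul _]
  push_cast
  refine Finset.sum_congr rfl fun k _ => ?_
  rw [integral_finsetSum _ fun l _ => (h_int k l).const_mul _]
  simp_rw [integral_const_mul]
  rw [Finset.sum_eq_single k, hvar, Complex.mul_conj']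
  · intro l _ hl
    rw [hcov k l hl.symm, mul_zero]
  · simp

/-- Uncorrelatedness of complex random variables is symmetric. -/
theorem integral_mul_conj_eq_zero_symm {Ω : Type*} [MeasurableSpace Ω] {μ : Measure Ω}
    {X Y : Ω → ℂ} (h : ∫ ω, X ω * (starRingEnd ℂ) (Y ω) ∂μ = 0) :
    ∫ ω, Y ω * (starRingEnd ℂ) (X ω) ∂μ = 0 := by
  have h' := congrArg (starRingEnd ℂ) h
  rw [← integral_conj, map_zero] at h'
  simpa [mul_comm] using h'

/-- Independent complex random variables, the second of mean zero, are uncorrelated. -/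
theorem ProbabilityTheory.IndepFun.integral_mul_conj_eq_zero {Ω : Type*} [MeasurableSpace Ω]
    {μ : Measure Ω} {X Y : Ω → ℂ} (h : IndepFun X Y μ)
    (hX : AEStronglyMeasurable X μ) (hY : AEStronglyMeasurable Y μ)
    (hY_mean : ∫ ω, Y ω ∂μ = 0) :
    ∫ ω, X ω * (starRingEnd ℂ) (Y ω) ∂μ = 0 := by
  have h_conj : IndepFun X (fun ω => (starRingEnd ℂ) (Y ω)) μ :=
    h.comp measurable_id Complex.continuous_conj.measurable
  rw [h_conj.integral_fun_mul_eq_mul_integral hX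
    (Complex.continuous_conj.comp_aestronglyMeasurable hY), integral_conj, hY_mean]
  simp

/-- With a zero-mean backhaul channel `g` of prior variance `υ_g`, noises as in
the ML case and independent of `g`, and `A = α²‖λ‖²‖t̃ₛ‖²/υₙ + ‖t_r‖²/σₙ² > 0`, the MAP
estimate `ĝ^MAP = (Σ_q α λ̄_q (t̃ₛᴴ r_q)/υₙ + (t_rᴴ x_r)/σₙ²)/(A + 1/υ_g)` has mean square
error `E|ĝ^MAP − g|² = (1/A)·υ_g/(υ_g + 1/A) = υ_g/(A υ_g + 1)`. -/
theorem map_estimate_mse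
    {Ω : Type*} [MeasurableSpace Ω] (μ : Measure Ω) [IsProbabilityMeasure μ]
    (Q Np Nr : ℕ) (α υn σn2 υg : ℝ)
    (hα : 0 < α) (hυn : 0 < υn) (hσn2 : 0 < σn2) (hυg : 0 < υg)
    (lam : ℤ → ℂ) (ts : EuclideanSpace ℂ (Fin Np)) (tr : EuclideanSpace ℂ (Fin Nr))
    (A : ℝ)
    (hA : A = α ^ 2 * (∑ q ∈ Icc (-(Q : ℤ)) (Q : ℤ), ‖lam q‖ ^ 2) * ‖ts‖ ^ 2 / υn
      + ‖tr‖ ^ 2 / σn2)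
    (hApos : 0 < A)
    -- the zero-mean backhaul channel with prior variance `υ_g`
    (g : Ω → ℂ) (hg_meas : Measurable g) (hg_L2 : MemLp g 2 μ)
    (hg_mean : ∫ ω, g ω ∂μ = 0) (hg_var : ∫ ω, ‖g ω‖ ^ 2 ∂μ = υg)
    -- the zero-mean noise vectors, independent of `g`, and their second-order statistics
    (w : ℤ → Ω → EuclideanSpace ℂ (Fin Np)) (wDr : Ω → EuclideanSpace ℂ (Fin Nr))
    (hw_meas : ∀ q, ∀ i, Measurable fun ω => w q ω i)
    (hwDr_meas : ∀ i, Measurable fun ω => wDr ω i)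
    (hw_L2 : ∀ q, ∀ i, MemLp (fun ω => w q ω i) 2 μ)
    (hwDr_L2 : ∀ i, MemLp (fun ω => wDr ω i) 2 μ)
    (hw_mean : ∀ q ∈ Icc (-(Q : ℤ)) (Q : ℤ), ∀ i, ∫ ω, w q ω i ∂μ = 0)
    (hwDr_mean : ∀ i, ∫ ω, wDr ω i ∂μ = 0)
    (h_indep : IndepFun
      (fun ω => ((fun q i => w q ω i, fun i => wDr ω i) :
        (ℤ → Fin Np → ℂ) × (Fin Nr → ℂ))) g μ)
    (hw_cov : ∀ q ∈ Icc (-(Q : ℤ)) (Q : ℤ), ∀ i j,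
      ∫ ω, w q ω i * (starRingEnd ℂ) (w q ω j) ∂μ = if i = j then (υn : ℂ) else 0)
    (hw_uncorr : ∀ q₁ ∈ Icc (-(Q : ℤ)) (Q : ℤ), ∀ q₂ ∈ Icc (-(Q : ℤ)) (Q : ℤ), q₁ ≠ q₂ →
      ∀ i j, ∫ ω, w q₁ ω i * (starRingEnd ℂ) (w q₂ ω j) ∂μ = 0)
    (hwDr_cov : ∀ i j,
      ∫ ω, wDr ω i * (starRingEnd ℂ) (wDr ω j) ∂μ = if i = j then (σn2 : ℂ) else 0)
    (hw_wDr_uncorr : ∀ q ∈ Icc (-(Q : ℤ)) (Q : ℤ), ∀ i j,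
      ∫ ω, w q ω i * (starRingEnd ℂ) (wDr ω j) ∂μ = 0)
    -- the observations and the MAP estimate
    (r : ℤ → Ω → EuclideanSpace ℂ (Fin Np)) (xr : Ω → EuclideanSpace ℂ (Fin Nr))
    (hr : ∀ q ω, r q ω = ((α : ℂ) * g ω * lam q) • ts + w q ω)
    (hxr : ∀ ω, xr ω = g ω • tr + wDr ω)
    (gMAP : Ω → ℂ)
    (hgMAP : ∀ ω, gMAP ω =
      ((∑ q ∈ Icc (-(Q : ℤ)) (Q : ℤ),
          (α : ℂ) * (starRingEnd ℂ) (lam q) * (inner ℂ ts (r q ω) : ℂ) / (υn : ℂ))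
        + (inner ℂ tr (xr ω) : ℂ) / (σn2 : ℂ)) / ((A + 1 / υg : ℝ) : ℂ)) :
    (∫ ω, ‖gMAP ω - g ω‖ ^ 2 ∂μ) = (1 / A) * (υg / (υg + 1 / A)) ∧
    (∫ ω, ‖gMAP ω - g ω‖ ^ 2 ∂μ) = υg / (A * υg + 1) := by
  have h_indep_w : ∀ q i, IndepFun (fun ω => w q ω i) g μ := fun q i =>
    h_indep.comp
      (φ := fun p : (ℤ → Fin Np → ℂ) × (Fin Nr → ℂ) => p.1 q i)
      (ψ := id) (by fun_prop) measurable_id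
  have h_indep_wDr : ∀ i, IndepFun (fun ω => wDr ω i) g μ := fun i =>
    h_indep.comp
      (φ := fun p : (ℤ → Fin Np → ℂ) × (Fin Nr → ℂ) => p.2 i)
      (ψ := id) (by fun_prop) measurable_id
  have hw_g : ∀ q i, ∫ ω, w q ω i * (starRingEnd ℂ) (g ω) ∂μ = 0 := fun q i =>
    (h_indep_w q i).integral_mul_conj_eq_zero (hw_L2 q i).1 hg_L2.1 hg_mean
  have hwDr_g : ∀ i, ∫ ω, wDr ω i * (starRingEnd ℂ) (g ω) ∂μ = 0 := fun i =>
    (h_indep_wDr i).integral_mul_conj_eq_zero (hwDr_L2 i).1 hg_L2.1 hg_mean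
  have hg_cov : ∫ ω, g ω * (starRingEnd ℂ) (g ω) ∂μ = υg := by
    simp_rw [Complex.mul_conj', ← Complex.ofReal_pow]
    rw [integral_complex_ofReal, hg_var]
  set D : ℝ := A + 1 / υg with hD
  have hDpos : 0 < D := by positivity
  have hD0 : (D : ℂ) ≠ 0 := by exact_mod_cast hDpos.ne'
  let S := Icc (-(Q : ℤ)) (Q : ℤ)
  let X : ((S × Fin Np) ⊕ Fin Nr) ⊕ Unit → Ω → ℂ :=
    Sum.elim (Sum.elim (fun p ω => w p.1 ω p.2) (fun i ω => wDr ω i)) (fun _ => g)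
  let c : ((S × Fin Np) ⊕ Fin Nr) ⊕ Unit → ℂ :=
    Sum.elim (Sum.elim
      (fun p => (α : ℂ) * (starRingEnd ℂ) (lam p.1) * (starRingEnd ℂ) (ts p.2) / (υn * D))
      (fun i => (starRingEnd ℂ) (tr i) / (σn2 * D))) (fun _ => -1 / ((υg : ℂ) * D))
  let v : ((S × Fin Np) ⊕ Fin Nr) ⊕ Unit → ℝ :=
    Sum.elim (Sum.elim (fun _ => υn) (fun _ => σn2)) (fun _ => υg)
  have h_err : ∀ ω, gMAP ω - g ω = ∑ k, c k * X k ω := by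
    intro ω
    have h_ts : ∀ q, (inner ℂ ts (r q ω) : ℂ) =
        α * g ω * lam q * (‖ts‖ : ℂ) ^ 2 + ∑ i, (starRingEnd ℂ) (ts i) * w q ω i := by
      intro q
      rw [hr, inner_add_right, inner_smul_right, inner_self_eq_norm_sq_to_K, PiLp.inner_apply]
      simp [mul_comm]
    have h_tr : (inner ℂ tr (xr ω) : ℂ) =
        g ω * (‖tr‖ : ℂ) ^ 2 + ∑ i, (starRingEnd ℂ) (tr i) * wDr ω i := by
      rw [hxr, inner_add_right, inner_smul_right, inner_self_eq_norm_sq_to_K, PiLp.inner_apply]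
      simp [mul_comm]
    have h_access : ∑ q ∈ Icc (-(Q : ℤ)) (Q : ℤ),
        (α : ℂ) * (starRingEnd ℂ) (lam q) * (inner ℂ ts (r q ω) : ℂ) / (υn : ℂ) =
        (α : ℂ) ^ 2 * (∑ q ∈ Icc (-(Q : ℤ)) (Q : ℤ), (‖lam q‖ : ℂ) ^ 2) * (‖ts‖ : ℂ) ^ 2 / υn
            * g ω
          + ∑ p : S × Fin Np, (α : ℂ) * (starRingEnd ℂ) (lam p.1) * (starRingEnd ℂ) (ts p.2)
            / υn * w p.1 ω p.2 := by
      rw [Fintype.sum_prod_type, Finset.sum_coe_sort S (fun q => ∑ i, (α : ℂ) *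
        (starRingEnd ℂ) (lam q) * (starRingEnd ℂ) (ts i) / υn * w q ω i), Finset.mul_sum,
        Finset.sum_mul, Finset.sum_div, Finset.sum_mul, ← Finset.sum_add_distrib]
      refine Finset.sum_congr rfl fun q _ => ?_
      rw [h_ts, ← Complex.mul_conj', mul_add, add_div, Finset.mul_sum, Finset.sum_div]
      congr 1
      · ring
      · exact Finset.sum_congr rfl fun i _ => by ring
    have h_backhaul : (inner ℂ tr (xr ω) : ℂ) / (σn2 : ℂ) =
        (‖tr‖ : ℂ) ^ 2 / σn2 * g ω + ∑ i, (starRingEnd ℂ) (tr i) / σn2 * wDr ω i := by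
      rw [h_tr, add_div, Finset.sum_div]
      congr 1
      · ring
      · exact Finset.sum_congr rfl fun i _ => by ring
    have hAc : (A : ℂ) =
        (α : ℂ) ^ 2 * (∑ q ∈ Icc (-(Q : ℤ)) (Q : ℤ), (‖lam q‖ : ℂ) ^ 2) * (‖ts‖ : ℂ) ^ 2 / υn
          + (‖tr‖ : ℂ) ^ 2 / σn2 := by
      rw [hA]
      push_cast
      rfl
    have hDc : (D : ℂ) = A + 1 / υg := by
      rw [hD]
      push_cast
      rfl
    have h_w : ∑ p : S × Fin Np, (α : ℂ) * (starRingEnd ℂ) (lam p.1) *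
        (starRingEnd ℂ) (ts p.2) / (υn * D) * w p.1 ω p.2 =
        (∑ p : S × Fin Np, (α : ℂ) * (starRingEnd ℂ) (lam p.1) * (starRingEnd ℂ) (ts p.2)
            / υn * w p.1 ω p.2) / D := by
      rw [Finset.sum_div]
      exact Finset.sum_congr rfl fun p _ => by field_simp
    have h_wDr : ∑ i, (starRingEnd ℂ) (tr i) / (σn2 * D) * wDr ω i =
        (∑ i, (starRingEnd ℂ) (tr i) / σn2 * wDr ω i) / D := by
      rw [Finset.sum_div]
      exact Finset.sum_congr rfl fun i _ => by field_simp
    simp only [Fintype.sum_sum_type, c, X, Sum.elim_inl, Sum.elim_inr, Finset.univ_unique,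
      Finset.sum_singleton]
    rw [hgMAP, h_w, h_wDr, h_access, h_backhaul]
    have h_g : g ω = (A * g ω + g ω / υg) / D := by
      rw [eq_div_iff hD0, hDc]
      ring
    have h_last : -1 / ((υg : ℂ) * D) * g ω = -(g ω / υg) / D := by field_simp
    rw [h_last]
    nth_rewrite 3 [h_g]
    rw [hAc]
    ring
  have h_mse : ∫ ω, ‖gMAP ω - g ω‖ ^ 2 ∂μ = υg / (A * υg + 1) := by
    simp_rw [h_err]
    rw [integral_norm_sq_sum_of_uncorrelated X c v]
    · simp only [Fintype.sum_sum_type, c, v, Sum.elim_inl, Sum.elim_inr, Finset.univ_unique,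
        Finset.sum_singleton]
      have h_w : ∑ p : S × Fin Np, ‖(α : ℂ) * (starRingEnd ℂ) (lam p.1) *
          (starRingEnd ℂ) (ts p.2) / (υn * D)‖ ^ 2 * υn =
          α ^ 2 * (∑ q ∈ Icc (-(Q : ℤ)) (Q : ℤ), ‖lam q‖ ^ 2) * ‖ts‖ ^ 2 / υn / D ^ 2 := by
        rw [EuclideanSpace.norm_sq_eq, mul_assoc, Finset.sum_mul_sum, Fintype.sum_prod_type,
          Finset.sum_coe_sort S (fun q => ∑ i, ‖(α : ℂ) * (starRingEnd ℂ) (lam q) *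
            (starRingEnd ℂ) (ts i) / (υn * D)‖ ^ 2 * υn)]
        simp_rw [Finset.mul_sum, Finset.sum_div]
        refine Finset.sum_congr rfl fun q _ => Finset.sum_congr rfl fun i _ => ?_
        simp only [norm_div, norm_mul, RCLike.norm_conj, Complex.norm_real, Real.norm_eq_abs,
          abs_of_pos hα, abs_of_pos hυn, abs_of_pos hDpos]
        field_simp
      have h_wDr : ∑ i, ‖(starRingEnd ℂ) (tr i) / ((σn2 : ℂ) * D)‖ ^ 2 * σn2 =
          ‖tr‖ ^ 2 / σn2 / D ^ 2 := by
        rw [EuclideanSpace.norm_sq_eq, Finset.sum_div, Finset.sum_div]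
        refine Finset.sum_congr rfl fun i _ => ?_
        simp only [norm_div, norm_mul, RCLike.norm_conj, Complex.norm_real, Real.norm_eq_abs,
          abs_of_pos hσn2, abs_of_pos hDpos]
        field_simp
      have h_g : ‖-1 / ((υg : ℂ) * D)‖ ^ 2 * υg = 1 / υg / D ^ 2 := by
        simp only [norm_div, norm_mul, norm_neg, norm_one, Complex.norm_real, Real.norm_eq_abs,
          abs_of_pos hυg, abs_of_pos hDpos]
        field_simp
      rw [h_w, h_wDr, h_g, ← add_div, ← add_div, ← hA, ← hD, sq, div_mul_cancel_left₀ hDpos.ne',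
        hD]
      field_simp
    · rintro ((p | i) | _)
      exacts [hw_L2 _ _, hwDr_L2 _, hg_L2]
    · rintro ((p | i) | _)
      · exact (hw_cov _ p.1.2 p.2 p.2).trans (if_pos rfl)
      · exact (hwDr_cov i i).trans (if_pos rfl)
      · exact hg_cov
    · rintro ((⟨q, i⟩ | i) | _) ((⟨q', j⟩ | j) | _) hkl
      · by_cases hq : q = q'
        · subst hq
          exact (hw_cov _ q.2 i j).trans (if_neg fun hij => hkl (by rw [hij]))
        · exact hw_uncorr _ q.2 _ q'.2 (fun h => hq (Subtype.ext h)) i j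
      · exact hw_wDr_uncorr _ q.2 i j
      · exact hw_g _ _
      · exact integral_mul_conj_eq_zero_symm (hw_wDr_uncorr _ q'.2 j i)
      · exact (hwDr_cov i j).trans (if_neg fun hij => hkl (by rw [hij]))
      · exact hwDr_g _
      · exact integral_mul_conj_eq_zero_symm (hw_g _ _)
      · exact integral_mul_conj_eq_zero_symm (hwDr_g _)
      · exact absurd rfl hkl
  refine ⟨?_, h_mse⟩
  rw [h_mse]
  field_simp
end
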